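/- arXiv:2506.08782 — 6 statements merged into one kernel-verified Lean document; each statement's English description precedes it below -/
import Mathlib

section
/- Let 1/2 ≤ p < 1, q = 1 - p, n ≥ 1, and 0 ≤ k ≤ n-1. Then the probability that the opponent of the overall winner accumulates exactly k wins satisfies P(W_{n,p} = k) = C(n+k-1, n-1) q^k p^n + α_{n,p,k}, where the error term α_{n,p,k} = C(n+k-1, k) q^n p^k satisfies 0 ≤ α_{n,p,k} ≤ (4 p q)^n. -/
/-- For `1/2 ≤ p < 1`, `q = 1 - p`, `n ≥ 1` and `0 ≤ k ≤ n-1`,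
`P(W_{n,p} = k) = C(n+k-1,k)(p^n q^k + q^n p^k)` decomposes as
`C(n+k-1, n-1) q^k p^n + α` where the error term `α = C(n+k-1,k) q^n p^k`
satisfies `0 ≤ α ≤ (4pq)^n`. -/
theorem statement2 (p : ℝ) (hp : 1 / 2 ≤ p) (hp1 : p < 1) (q : ℝ) (hq : q = 1 - p)
    (n k : ℕ) (hn : 1 ≤ n) (hk : k ≤ n - 1) :
    ((n + k - 1).choose k : ℝ) * (p ^ n * q ^ k + q ^ n * p ^ k)
        = ((n + k - 1).choose (n - 1) : ℝ) * q ^ k * p ^ n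
            + ((n + k - 1).choose k : ℝ) * q ^ n * p ^ k
      ∧ 0 ≤ ((n + k - 1).choose k : ℝ) * q ^ n * p ^ k
      ∧ ((n + k - 1).choose k : ℝ) * q ^ n * p ^ k ≤ (4 * p * q) ^ n := by
  have hq0 : 0 ≤ q := by linarith
  have hp0 : 0 ≤ p := by linarith
  have hsymm : (n + k - 1).choose (n - 1) = (n + k - 1).choose k :=
    Nat.choose_symm_of_eq_add (by omega)
  have hchoose : ((n + k - 1).choose k : ℝ) ≤ 2 ^ (n + k) := by
    exact_mod_cast (Nat.choose_le_two_pow (n + k - 1) k).trans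
      (Nat.pow_le_pow_right two_pos (by omega))
  have hpow : (2 * p) ^ k ≤ (2 * p) ^ n := pow_le_pow_right₀ (by linarith) (by omega)
  refine ⟨by rw [hsymm]; ring, by positivity, ?_⟩
  calc ((n + k - 1).choose k : ℝ) * q ^ n * p ^ k
      ≤ 2 ^ (n + k) * q ^ n * p ^ k := by gcongr
    _ = (2 * q) ^ n * (2 * p) ^ k := by simp only [mul_pow, pow_add]; ring
    _ ≤ (2 * q) ^ n * (2 * p) ^ n := by gcongr
    _ = (4 * p * q) ^ n := by rw [← mul_pow]; congr 1; ring
end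

section
/- Fix an integer k ≥ 1. Then the sequence n ↦ ( n · (2n - 1 - k)! · n! ) / ( (2n)! · (n - k)! ) (as a real number, for n ≥ k) converges to 1/2^{k+1} as n → ∞. Consequently, in the anti-OK Corral model the limiting probability that a given player wins overall while the other player wins exactly n - k rounds equals 1/2^{k+1}, and the limiting distribution of the winner's net profit is an equal mixture of two Geometric(1/2) distributions on the positive integers. -/
open Filter Topology

theorem tendsto_sub_div_two_mul_sub (k : ℕ) :
    Tendsto (fun n : ℕ => ((n : ℝ) - k) / (2 * n - 1 - k)) atTop (𝓝 (1 / 2)) := by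
  have h (c : ℝ) : Tendsto (fun n : ℕ => c / (n : ℝ)) atTop (𝓝 0) :=
    tendsto_const_div_atTop_nhds_zero_nat c
  have key : Tendsto (fun n : ℕ => (1 - (k : ℝ) / n) / (2 - (1 + k : ℝ) / n)) atTop
      (𝓝 ((1 - 0) / (2 - 0))) :=
    (tendsto_const_nhds.sub (h k)).div (tendsto_const_nhds.sub (h (1 + k))) (by norm_num)
  rw [sub_zero, sub_zero] at key
  refine key.congr' ?_
  filter_upwards [eventually_ge_atTop 1] with n hn
  have hn0 : (n : ℝ) ≠ 0 := by positivity
  rw [← mul_div_mul_left _ _ hn0]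
  congr 1 <;> field_simp
  ring

theorem tendsto_antiOKCorral_prob (k : ℕ) :
    Tendsto
      (fun n : ℕ =>
        ((n : ℝ) * (Nat.factorial (2 * n - 1 - k)) * (Nat.factorial n)) /
          ((Nat.factorial (2 * n)) * (Nat.factorial (n - k))))
      atTop (𝓝 (1 / 2 ^ (k + 1))) := by
  induction k with
  | zero =>
    refine tendsto_const_nhds.congr' ?_
    filter_upwards [eventually_ge_atTop 1] with n hn
    obtain ⟨m, rfl⟩ := Nat.exists_eq_add_of_le' hn
    rw [show 2 * (m + 1) - 1 - 0 = 2 * m + 1 by omega,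
      show 2 * (m + 1) = 2 * m + 1 + 1 by ring, Nat.sub_zero, Nat.factorial_succ (2 * m + 1)]
    have h₁ : ((2 * m + 1).factorial : ℝ) ≠ 0 := by positivity
    have h₂ : ((m + 1).factorial : ℝ) ≠ 0 := by positivity
    have h₃ : (2 * (m : ℝ) + 1 + 1) ≠ 0 := by positivity
    push_cast
    field_simp
    ring
  | succ k ih =>
    have key := ih.mul (tendsto_sub_div_two_mul_sub k)
    rw [show (1 : ℝ) / 2 ^ (k + 1) * (1 / 2) = 1 / 2 ^ (k + 1 + 1) by
      rw [pow_succ 2 (k + 1)]; ring] at key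
    refine key.congr' ?_
    filter_upwards [eventually_ge_atTop (k + 1)] with n hn
    obtain ⟨m, rfl⟩ := Nat.exists_eq_add_of_le' hn
    rw [show 2 * (m + (k + 1)) - 1 - k = 2 * m + k + 1 by omega,
      show 2 * (m + (k + 1)) - 1 - (k + 1) = 2 * m + k by omega,
      show m + (k + 1) - k = m + 1 by omega, show m + (k + 1) - (k + 1) = m by omega,
      Nat.factorial_succ (2 * m + k), Nat.factorial_succ m]
    have h₁ : (2 * (m : ℝ) + k + 1) ≠ 0 := by positivity
    have h₂ : ((m : ℝ) + 1) ≠ 0 := by positivity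
    have h₃ : (m.factorial : ℝ) ≠ 0 := by positivity
    have h₄ : ((2 * (m + (k + 1))).factorial : ℝ) ≠ 0 := by positivity
    push_cast
    rw [show (m : ℝ) + (k + 1) - k = m + 1 by ring,
      show 2 * ((m : ℝ) + (k + 1)) - 1 - k = 2 * m + k + 1 by ring]
    field_simp

/-- Fix an integer `k ≥ 1`. In the anti-OK Corral model, the probability that a
given player wins overall while the other wins exactly `n - k` rounds,
`n (2n-1-k)! n! / ((2n)! (n-k)!)`, converges to `1/2^{k+1}` as `n → ∞`.
Hence the limiting net-profit distribution of a player is an equal mixture of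
two Geometric(1/2) distributions on the positive integers. -/
theorem statement8 (k : ℕ) (hk : 1 ≤ k) :
    Tendsto
      (fun n : ℕ =>
        ((n : ℝ) * (Nat.factorial (2 * n - 1 - k)) * (Nat.factorial n)) /
          ((Nat.factorial (2 * n)) * (Nat.factorial (n - k))))
      atTop (𝓝 (1 / 2 ^ (k + 1))) := by
  exact tendsto_antiOKCorral_prob k
end

section
/- Let 0 < λ < 1 and n ≥ 1. Let τ_X and τ_Y be independent real random variables where τ_X has the Gamma distribution with shape n and rate 1 (density u^{n-1} e^{-u}/(n-1)! on (0,∞)) and τ_Y has the Gamma distribution with shape n and rate λ (density λ^n u^{n-1} e^{-λu}/(n-1)! on (0,∞)). Then P(τ_X - τ_Y ≥ 0) ≤ ( 4λ/(λ+1)² )^n, and in particular this probability tends to 0 as n → ∞. -/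
open MeasureTheory ProbabilityTheory Filter Topology

/-- Exponential tilting of the Gamma density: multiplying by `exp (t x)` lowers the rate by `t`. -/
lemma gammaPDF_mul_exp {a r t : ℝ} (hr : 0 < r) (htr : t < r) (x : ℝ) :
    gammaPDF a r x * ENNReal.ofReal (Real.exp (t * x)) =
      ENNReal.ofReal ((r / (r - t)) ^ a) * gammaPDF a (r - t) x := by
  have hrt : 0 < r - t := sub_pos.mpr htr
  rcases lt_or_ge x 0 with hx | hx
  · simp [gammaPDF_of_neg hx]
  · have hexp : Real.exp (-((r - t) * x)) = Real.exp (-(r * x)) * Real.exp (t * x) := by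
      rw [← Real.exp_add]
      ring_nf
    have hpow : (r - t) ^ a ≠ 0 := (Real.rpow_pos_of_pos hrt a).ne'
    rw [gammaPDF_of_nonneg hx, gammaPDF_of_nonneg hx, ← ENNReal.ofReal_mul' (Real.exp_nonneg _),
      ← ENNReal.ofReal_mul (by positivity), Real.div_rpow hr.le hrt.le, hexp]
    congr 1
    field_simp

/-- The moment generating function of the Gamma distribution. -/
lemma lintegral_exp_mul_gammaMeasure {a r t : ℝ} (ha : 0 < a) (hr : 0 < r) (htr : t < r) :
    ∫⁻ x, ENNReal.ofReal (Real.exp (t * x)) ∂gammaMeasure a r =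
      ENNReal.ofReal ((r / (r - t)) ^ a) := by
  have hpdf (s : ℝ) : Measurable (gammaPDF a s) :=
    (measurable_gammaPDFReal a s).ennreal_ofReal
  rw [gammaMeasure, lintegral_withDensity_eq_lintegral_mul _ (hpdf r) (by fun_prop)]
  simp only [Pi.mul_apply, gammaPDF_mul_exp hr htr]
  rw [lintegral_const_mul _ (hpdf _), lintegral_gammaPDF_eq_one ha (sub_pos.mpr htr), mul_one]

/-- The Chernoff bound for the difference of two independent random variables. -/
lemma ProbabilityTheory.IndepFun.measure_sub_nonneg_le {Ω : Type*} [MeasurableSpace Ω]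
    {P : Measure Ω} {X Y : Ω → ℝ} (hX : Measurable X) (hY : Measurable Y)
    (hindep : IndepFun X Y P) {t : ℝ} (ht : 0 ≤ t) :
    P {ω | 0 ≤ X ω - Y ω} ≤ (∫⁻ x, ENNReal.ofReal (Real.exp (t * x)) ∂P.map X) *
      ∫⁻ y, ENNReal.ofReal (Real.exp (-t * y)) ∂P.map Y := by
  have hmeas (s : ℝ) : Measurable fun x : ℝ ↦ ENNReal.ofReal (Real.exp (s * x)) := by fun_prop
  have hprod := lintegral_mul_eq_lintegral_mul_lintegral_of_indepFun ((hmeas t).comp hX)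
    ((hmeas (-t)).comp hY) (hindep.comp (hmeas t) (hmeas (-t)))
  simp only [Pi.mul_apply, Function.comp_apply] at hprod
  rw [lintegral_map (hmeas t) hX, lintegral_map (hmeas (-t)) hY, ← hprod,
    ← lintegral_indicator_one (s := {ω | 0 ≤ X ω - Y ω})
      (measurableSet_le measurable_const (hX.sub hY))]
  refine lintegral_mono (Set.indicator_le fun ω (hω : 0 ≤ X ω - Y ω) ↦ ?_)
  rw [Pi.one_apply, ← ENNReal.ofReal_mul (Real.exp_nonneg _), ← Real.exp_add, ENNReal.one_le_ofReal,
    Real.one_le_exp_iff]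
  linarith [mul_nonneg ht hω]

/-- Let `0 < λ < 1`, `n ≥ 1`, and let `τ_X, τ_Y` be independent random variables with
`τ_X ~ Gamma(n, 1)` and `τ_Y ~ Gamma(n, λ)`. Then
`P(τ_X - τ_Y ≥ 0) ≤ (4λ/(λ+1)²)^n`, and this bound tends to `0` as `n → ∞`. -/
theorem statement11 {Ω : Type*} [MeasurableSpace Ω] (P : Measure Ω) [IsProbabilityMeasure P]
    (l : ℝ) (hl0 : 0 < l) (hl1 : l < 1) (n : ℕ) (hn : 1 ≤ n)
    (X Y : Ω → ℝ) (hX : Measurable X) (hY : Measurable Y)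
    (hindep : IndepFun X Y P)
    (hXlaw : P.map X = gammaMeasure n 1)
    (hYlaw : P.map Y = gammaMeasure n l) :
    P {ω | 0 ≤ X ω - Y ω} ≤ ENNReal.ofReal ((4 * l / (l + 1) ^ 2) ^ n)
    ∧ Tendsto (fun m : ℕ => ((4 * l / (l + 1) ^ 2) ^ m : ℝ)) atTop (𝓝 0) := by
  constructor
  · have hn0 : (0 : ℝ) < n := by exact_mod_cast hn
    refine (hindep.measure_sub_nonneg_le hX hY (t := (1 - l) / 2) (by linarith)).trans_eq ?_
    rw [hXlaw, hYlaw, lintegral_exp_mul_gammaMeasure hn0 one_pos (by linarith),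
      lintegral_exp_mul_gammaMeasure hn0 hl0 (by linarith), Real.rpow_natCast, Real.rpow_natCast,
      show 1 - (1 - l) / 2 = (l + 1) / 2 by ring, show l - -((1 - l) / 2) = (l + 1) / 2 by ring,
      ← ENNReal.ofReal_mul (by positivity), ← mul_pow]
    congr 2
    field_simp
    norm_num
  · refine tendsto_pow_atTop_nhds_zero_of_lt_one (by positivity) ?_
    rw [div_lt_one (by positivity)]
    nlinarith [sq_pos_of_pos (sub_pos.mpr hl1)]
end

section
/- Let m ≥ 1 be an integer and a ≥ 0 a real number. Then Σ_{k ∈ ℕ : |k - m| ≥ a} C(m+k-1, k) · (1/2)^{m+k} ≤ 2 · exp( -a² / (4(a + m)) ). That is, if η is a negative binomial random variable with parameters m and 1/2 (so P(η = k) = C(m+k-1, k) 2^{-(m+k)} for k ∈ ℕ, with mean m), then P(|η - m| ≥ a) ≤ 2 exp(-a²/(4(a+m))). -/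
theorem hasSum_negBinomial_mul_pow {m : ℕ} (hm : 1 ≤ m) {x : ℝ} (hx0 : 0 ≤ x) (hx : x < 2) :
    HasSum (fun k : ℕ => ((m + k - 1).choose k : ℝ) * (1 / 2 : ℝ) ^ (m + k) * x ^ k)
      (1 / (2 - x) ^ m) := by
  obtain ⟨n, rfl⟩ : ∃ n, m = n + 1 := ⟨m - 1, by omega⟩
  have hr : ‖x / 2‖ < 1 := by
    rw [Real.norm_of_nonneg (by positivity)]; linarith
  have h := (hasSum_choose_mul_geometric_of_norm_lt_one n hr).mul_left ((1 / 2 : ℝ) ^ (n + 1))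
  have hlim : 1 / (2 - x) ^ (n + 1) = (1 / 2 : ℝ) ^ (n + 1) * (1 / (1 - x / 2) ^ (n + 1)) := by
    rw [show 2 - x = 2 * (1 - x / 2) by ring, mul_pow, div_pow, one_pow, div_mul_div_comm, one_mul]
  rw [hlim]
  refine Eq.mp (congrArg (HasSum · _) (funext fun k => ?_)) h
  have e : n + 1 + k - 1 = k + n := by omega
  rw [e, Nat.choose_symm_add, show x / 2 = 1 / 2 * x by ring, mul_pow, pow_add _ (n + 1) k]
  ring

/-- An exponentially tilted majorant of the negative binomial weights on the tail cut off at
`m + s`, upper if `0 ≤ s` and lower if `s ≤ 0`. -/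
theorem exists_summable_negBinomial_tail_majorant {m : ℕ} (hm : 1 ≤ m) (s : ℝ)
    (hs : 0 < 2 * m + s) :
    ∃ g : ℕ → ℝ, (∀ k, 0 ≤ g k) ∧
      (∀ k : ℕ, 0 ≤ s * (k - m - s) →
        ((m + k - 1).choose k : ℝ) * (1 / 2 : ℝ) ^ (m + k) ≤ g k) ∧
      Summable g ∧ ∑' k, g k ≤ Real.exp (-s ^ 2 / (2 * (2 * m + s))) := by
  set t : ℝ := s / (2 * m + s) with ht
  set u : ℝ := Real.log (Real.cosh t) with hu
  have hexpu : Real.exp u = Real.cosh t := Real.exp_log (Real.cosh_pos t)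
  have hut : u ≤ t ^ 2 / 2 := by
    rw [hu, Real.log_le_iff_le_exp (Real.cosh_pos t)]
    exact Real.cosh_le_exp_half_sq t
  have hx2 : 2 - Real.exp (t - u) = Real.exp (-t - u) := by
    rw [Real.exp_sub, Real.exp_sub, hexpu]
    have := Real.cosh_pos t
    field_simp
    rw [Real.cosh_eq]
    ring
  have hsum := (hasSum_negBinomial_mul_pow hm (Real.exp_pos (t - u)).le
    (by linarith [Real.exp_pos (-t - u)])).mul_right (Real.exp (-((m + s) * (t - u))))
  refine ⟨_, fun k => by positivity, fun k hk => ?_, hsum.summable, ?_⟩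
  · have hL : 0 ≤ ((k : ℝ) - m - s) * (t - u) := by
      rcases lt_trichotomy s 0 with h | h | h
      · have hk' : (k : ℝ) - m - s ≤ 0 := by nlinarith
        have ht0 : t ≤ 0 := div_nonpos_of_nonpos_of_nonneg h.le hs.le
        have hu0 : 0 ≤ u := Real.log_nonneg (Real.one_le_cosh t)
        exact mul_nonneg_of_nonpos_of_nonpos hk' (by linarith)
      · simp [hu, ht, h]
      · have hk' : 0 ≤ (k : ℝ) - m - s := by nlinarith
        have ht0 : 0 ≤ t := by positivity
        have hut' : u ≤ t := by
          rw [hu, Real.log_le_iff_le_exp (Real.cosh_pos t), Real.cosh_eq]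
          have : Real.exp (-t) ≤ Real.exp t := Real.exp_le_exp.2 (by linarith)
          linarith
        exact mul_nonneg hk' (by linarith)
    rw [mul_assoc _ (Real.exp (t - u) ^ k), ← Real.exp_nat_mul, ← Real.exp_add]
    refine le_mul_of_one_le_right (by positivity) (Real.one_le_exp ?_)
    linarith
  · rw [hsum.tsum_eq, hx2, ← Real.exp_nat_mul, one_div, ← Real.exp_neg, ← Real.exp_add,
      Real.exp_le_exp]
    calc -((m : ℝ) * (-t - u)) + -((m + s) * (t - u))
        = (2 * m + s) * u - s * t := by ring
      _ ≤ (2 * m + s) * (t ^ 2 / 2) - s * t := by gcongr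
      _ = -s ^ 2 / (2 * (2 * m + s)) := by
        rw [ht]
        field_simp
        ring


/-- Let `m ≥ 1` be an integer and `a ≥ 0` a real number. If `η` is negative binomial with
parameters `m` and `1/2` (so `P(η = k) = C(m+k-1, k) 2^{-(m+k)}`, with mean `m`), then
`P(|η - m| ≥ a) = ∑_{k : |k-m| ≥ a} C(m+k-1,k) (1/2)^{m+k} ≤ 2 exp(-a²/(4(a+m)))`. -/
theorem statement12 (m : ℕ) (hm : 1 ≤ m) (a : ℝ) (ha : 0 ≤ a) :
    (∑' k : ℕ,
        if a ≤ |(k : ℝ) - m| then ((m + k - 1).choose k : ℝ) * (1 / 2 : ℝ) ^ (m + k) else 0)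
      ≤ 2 * Real.exp (-a ^ 2 / (4 * (a + m))) := by
  have hm' : (1 : ℝ) ≤ m := by exact_mod_cast hm
  have key : ∀ d : ℝ, 0 < d → d ≤ 4 * (a + m) →
      Real.exp (-a ^ 2 / d) ≤ Real.exp (-a ^ 2 / (4 * (a + m))) := by
    intro d hd h
    rw [Real.exp_le_exp, neg_div, neg_div, neg_le_neg_iff]
    gcongr
  obtain ⟨g, hg0, hg, hgs, hgE⟩ :=
    exists_summable_negBinomial_tail_majorant hm a (by linarith)
  have lower : ∃ f : ℕ → ℝ, (∀ k, 0 ≤ f k) ∧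
      (∀ k : ℕ, (k : ℝ) - m ≤ -a →
        ((m + k - 1).choose k : ℝ) * (1 / 2 : ℝ) ^ (m + k) ≤ f k) ∧
      Summable f ∧ ∑' k, f k ≤ Real.exp (-a ^ 2 / (4 * (a + m))) := by
    by_cases ham : a ≤ m
    · obtain ⟨f, hf0, hf, hfs, hfE⟩ :=
        exists_summable_negBinomial_tail_majorant hm (-a) (by linarith)
      refine ⟨f, hf0, fun k hk => hf k (by nlinarith), hfs, hfE.trans ?_⟩
      rw [neg_sq]
      exact key _ (by linarith) (by linarith)
    · refine ⟨fun _ => 0, fun _ => le_rfl, fun k hk => ?_, summable_zero, ?_⟩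
      · have : (0 : ℝ) ≤ k := k.cast_nonneg
        linarith
      · rw [tsum_zero]
        positivity
  obtain ⟨f, hf0, hf, hfs, hfE⟩ := lower
  have hle : ∀ k : ℕ,
      (if a ≤ |(k : ℝ) - m| then ((m + k - 1).choose k : ℝ) * (1 / 2 : ℝ) ^ (m + k) else 0)
        ≤ g k + f k := by
    intro k
    split_ifs with h
    · rcases le_abs.1 h with h | h
      · linarith [hg k (mul_nonneg ha (by linarith)), hf0 k]
      · linarith [hf k (by linarith), hg0 k]
    · exact add_nonneg (hg0 k) (hf0 k)
  have hsum := Summable.of_nonneg_of_le (fun k => by positivity) hle (hgs.add hfs)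
  calc _ ≤ ∑' k, (g k + f k) := hsum.tsum_le_tsum hle (hgs.add hfs)
    _ = ∑' k, g k + ∑' k, f k := hgs.tsum_add hfs
    _ ≤ _ := by linarith [hgE.trans (key _ (by linarith) (by linarith))]
end

section
/- For every real y ≥ 0: y · ln(1 + y/(2+y)) + ln(1 - y²/(2+y)²) ≥ y²/(4(y+1)). -/
/-- The difference of the rate function and its rational minorant, with the logarithms expanded. -/
noncomputable def rateGap (t : ℝ) : ℝ :=
  (1 + t) * Real.log (1 + t) - (2 + t) * Real.log (2 + t) + (2 + t) * Real.log 2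
    - t ^ 2 / (4 * (t + 1))

theorem hasDerivAt_rateGap {t : ℝ} (ht : 0 ≤ t) :
    HasDerivAt rateGap (Real.log (1 + t / (2 + t)) - t * (t + 2) / (4 * (t + 1) ^ 2)) t := by
  have h1 : 1 + t ≠ 0 := by positivity
  have h1' : t + 1 ≠ 0 := by positivity
  have h2 : 2 + t ≠ 0 := by positivity
  have d1 : HasDerivAt (fun s : ℝ => 1 + s) 1 t := (hasDerivAt_id t).const_add 1
  have d2 : HasDerivAt (fun s : ℝ => 2 + s) 1 t := (hasDerivAt_id t).const_add 2
  have d3 : HasDerivAt (fun s : ℝ => 4 * (s + 1)) (4 * 1) t :=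
    ((hasDerivAt_id t).add_const 1).const_mul 4
  have d := (((d1.mul (d1.log h1)).sub (d2.mul (d2.log h2))).add
    (d2.mul_const (Real.log 2))).sub ((hasDerivAt_pow 2 t).div d3 (by positivity))
  refine d.congr_deriv ?_
  have hx : 1 + t / (2 + t) = 2 * (1 + t) / (2 + t) := by field_simp; ring
  rw [hx, Real.log_div (by positivity) h2, Real.log_mul two_ne_zero h1]
  field_simp
  ring

theorem rational_le_log {t : ℝ} (ht : 0 ≤ t) :
    t * (t + 2) / (4 * (t + 1) ^ 2) ≤ Real.log (1 + t / (2 + t)) := by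
  refine le_trans ?_ (Real.le_log_one_add_of_nonneg (div_nonneg ht (by positivity)))
  have hx : 2 * (t / (2 + t)) / (t / (2 + t) + 2) = 2 * t / (3 * t + 4) := by
    field_simp
    ring
  rw [hx, div_le_div_iff₀ (by positivity) (by positivity)]
  have h : 0 ≤ t * (t * (5 * t + 6)) := by positivity
  linarith

theorem monotoneOn_rateGap : MonotoneOn rateGap (Set.Ici 0) := by
  refine monotoneOn_of_hasDerivWithinAt_nonneg (convex_Ici 0)
    (fun t ht => (hasDerivAt_rateGap ht).continuousAt.continuousWithinAt)
    (fun t ht => (hasDerivAt_rateGap (interior_subset ht)).hasDerivWithinAt)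
    (fun t ht => sub_nonneg.2 (rational_le_log (interior_subset ht)))

/-- For every real `y ≥ 0`:
`y ln(1 + y/(2+y)) + ln(1 - y²/(2+y)²) ≥ y²/(4(y+1))`. -/
theorem statement15 (y : ℝ) (hy : 0 ≤ y) :
    y * Real.log (1 + y / (2 + y)) + Real.log (1 - y ^ 2 / (2 + y) ^ 2)
      ≥ y ^ 2 / (4 * (y + 1)) := by
  have h1 : 1 + y ≠ 0 := by positivity
  have h2 : 2 + y ≠ 0 := by positivity
  have hgap : rateGap 0 ≤ rateGap y := monotoneOn_rateGap Set.self_mem_Ici hy hy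
  have hx : 1 + y / (2 + y) = 2 * (1 + y) / (2 + y) := by field_simp; ring
  have hz : 1 - y ^ 2 / (2 + y) ^ 2 = 2 ^ 2 * (1 + y) / (2 + y) ^ 2 := by field_simp; ring
  rw [hx, hz, Real.log_div (by positivity) h2, Real.log_mul two_ne_zero h1,
    Real.log_div (by positivity) (by positivity), Real.log_mul (by norm_num) h1,
    Real.log_pow, Real.log_pow]
  simp only [rateGap, add_zero, Real.log_one] at hgap
  norm_num at hgap ⊢
  linarith
end

section
/- For every integer n ≥ 2: ( (2n)! / ((n-1)!)² ) · ∫_0^1 x (1-x)^{n-1} / (2-x)^{2n} dx = (1/(n-1)) · ( (2n)! / ( ((n-1)!)² · 2^{2n-1} ) - n ). -/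
open intervalIntegral in
/-- The fundamental theorem of calculus for rational functions `g / (1 + u) ^ (m + 1)` with
continuous `g` on `[0, 1]`. -/
theorem integral_div_one_add_pow {p p' g : ℝ → ℝ} {k m : ℕ}
    (hp : ∀ u, HasDerivAt p (p' u) u) (hg : Continuous g)
    (h : ∀ u, g u * (1 + u) ^ (k + 1) =
      (p' u * (1 + u) - (k + 1) * p u) * (1 + u) ^ m) :
    ∫ u in (0 : ℝ)..1, g u / (1 + u) ^ (m + 1) = p 1 / 2 ^ (k + 1) - p 0 := by
  have hne : ∀ u ∈ Set.uIcc (0 : ℝ) 1, 1 + u ≠ 0 := by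
    intro u hu
    rw [Set.uIcc_of_le zero_le_one] at hu
    linarith [hu.1]
  rw [integral_eq_sub_of_hasDerivAt (f := fun u => p u / (1 + u) ^ (k + 1))]
  · norm_num
  · intro u hu
    have h0 := hne u hu
    have hd := (hp u).div (((hasDerivAt_id u).const_add 1).pow (k + 1)) (pow_ne_zero (k + 1) h0)
    refine HasDerivAt.congr_deriv (f := fun u => p u / (1 + u) ^ (k + 1)) hd ?_
    simp only [id, Nat.add_sub_cancel, Pi.pow_apply, mul_one]
    symm
    rw [div_eq_div_iff (pow_ne_zero _ h0) (pow_ne_zero _ (pow_ne_zero _ h0))]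
    push_cast
    linear_combination (1 + u) ^ (k + 1) * h u
  · apply ContinuousOn.intervalIntegrable
    exact hg.continuousOn.div (by fun_prop) fun u hu => pow_ne_zero _ (hne u hu)

theorem intervalIntegrable_div_one_add_pow {g : ℝ → ℝ} (hg : Continuous g) (m : ℕ) :
    IntervalIntegrable (fun u => g u / (1 + u) ^ m) MeasureTheory.volume 0 1 := by
  apply ContinuousOn.intervalIntegrable
  refine hg.continuousOn.div (by fun_prop) fun u hu => pow_ne_zero _ ?_
  rw [Set.uIcc_of_le zero_le_one] at hu
  linarith [hu.1]

/-- Half of the Beta integral `B(m + 1, m + 1)`. -/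
theorem integral_pow_div_one_add_pow (m : ℕ) :
    ∫ u in (0 : ℝ)..1, u ^ m / (1 + u) ^ (2 * m + 2) =
      (m.factorial : ℝ) ^ 2 / (2 * (2 * m + 1).factorial) := by
  induction m with
  | zero =>
    have h := integral_div_one_add_pow (p := fun _ => -1) (p' := fun _ => 0)
      (g := fun _ => 1) (k := 0) (m := 1) (fun u => hasDerivAt_const u _) continuous_const
      (fun u => by norm_num)
    norm_num at h ⊢
    exact h
  | succ m ih =>
    have h := integral_div_one_add_pow (k := 2 * m + 2) (m := 2 * m + 3)
      (p := fun u => u ^ (m + 1) * (1 - u))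
      (p' := fun u => (m + 1) * u ^ m * (1 - u) - u ^ (m + 1))
      (g := fun u => (m + 1) * u ^ m * (1 + u) ^ 2 - (4 * m + 6) * u ^ (m + 1))
      (fun u => by
        refine HasDerivAt.congr_deriv (f := fun u : ℝ => u ^ (m + 1) * (1 - u))
          ((hasDerivAt_pow (m + 1) u).mul ((hasDerivAt_id u).const_sub 1)) ?_
        simp
        ring)
      (by fun_prop) (fun u => by push_cast; ring)
    have hsplit : ∫ u in (0 : ℝ)..1, ((m + 1) * u ^ m * (1 + u) ^ 2 -
          (4 * m + 6) * u ^ (m + 1)) / (1 + u) ^ (2 * m + 3 + 1) =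
        ∫ u in (0 : ℝ)..1, ((m + 1) * (u ^ m / (1 + u) ^ (2 * m + 2)) -
          (4 * m + 6) * (u ^ (m + 1) / (1 + u) ^ (2 * (m + 1) + 2))) := by
      refine intervalIntegral.integral_congr fun u hu => ?_
      rw [Set.uIcc_of_le zero_le_one] at hu
      have h0 : 1 + u ≠ 0 := by linarith [hu.1]
      have e : 2 * (m + 1) + 2 = 2 * m + 2 + 2 := by ring
      simp only [e]
      field_simp
      ring
    rw [hsplit, intervalIntegral.integral_sub
      ((intervalIntegrable_div_one_add_pow (by fun_prop) _).const_mul _)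
      ((intervalIntegrable_div_one_add_pow (by fun_prop) _).const_mul _),
      intervalIntegral.integral_const_mul, intervalIntegral.integral_const_mul, ih] at h
    simp only [sub_self, mul_zero, zero_div, ne_eq, Nat.add_eq_zero_iff, one_ne_zero, and_false,
      not_false_eq_true, zero_pow, zero_mul] at h
    have e : 2 * (m + 1) + 1 = 2 * m + 1 + 1 + 1 := by ring
    have hf : ((2 * m + 1).factorial : ℝ) ≠ 0 := by positivity
    have h6 : (4 * m + 6 : ℝ) ≠ 0 := by positivity
    refine mul_left_cancel₀ h6 ((sub_eq_zero.mp h).symm.trans ?_)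
    rw [e, Nat.factorial_succ (2 * m + 1 + 1), Nat.factorial_succ (2 * m + 1),
      Nat.factorial_succ m]
    push_cast
    have h3 : (2 * m + 1 + 1 + 1 : ℝ) ≠ 0 := by positivity
    have h2 : (2 * m + 1 + 1 : ℝ) ≠ 0 := by positivity
    field_simp
    ring

/-- For every integer `n ≥ 2`:
`((2n)!/((n-1)!)²) ∫_0^1 x(1-x)^{n-1}/(2-x)^{2n} dx
  = (1/(n-1)) ((2n)!/(((n-1)!)² 2^{2n-1}) - n)`. -/
theorem statement17 (n : ℕ) (hn : 2 ≤ n) :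
    ((Nat.factorial (2 * n) : ℝ) / ((Nat.factorial (n - 1) : ℝ) ^ 2)) *
        ∫ x in (0 : ℝ)..1, x * (1 - x) ^ (n - 1) / (2 - x) ^ (2 * n)
      = (1 / ((n : ℝ) - 1)) *
          ((Nat.factorial (2 * n) : ℝ) / ((Nat.factorial (n - 1) : ℝ) ^ 2 * 2 ^ (2 * n - 1))
            - n) := by
  obtain ⟨m, rfl⟩ : ∃ m, n = m + 1 := ⟨n - 1, by omega⟩
  have hm : (m : ℝ) ≠ 0 := by
    have : m ≠ 0 := by omega
    exact_mod_cast this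
  have hsubst : ∫ x in (0 : ℝ)..1, x * (1 - x) ^ m / (2 - x) ^ (2 * m + 2) =
      ∫ u in (0 : ℝ)..1, (1 - u) * u ^ m / (1 + u) ^ (2 * m + 2) := by
    have h := intervalIntegral.integral_comp_sub_left (a := 0) (b := 1)
      (fun u : ℝ => (1 - u) * u ^ m / (1 + u) ^ (2 * m + 2)) 1
    rw [sub_self, sub_zero] at h
    rw [← h]
    congr 1
    ext x
    ring_nf
  have hprim := integral_div_one_add_pow (k := 2 * m) (m := 2 * m + 1)
    (p := fun u => u ^ (m + 1)) (p' := fun u => (m + 1) * u ^ m)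
    (g := fun u => m * ((1 - u) * u ^ m) + u ^ m)
    (fun u => by simpa using hasDerivAt_pow (m + 1) u)
    (by fun_prop) (fun u => by push_cast; ring)
  simp only [add_div, mul_div_assoc] at hprim
  rw [intervalIntegral.integral_add
    (IntervalIntegrable.const_mul (by
      simpa only [mul_div_assoc] using intervalIntegrable_div_one_add_pow
        (g := fun u => (1 - u) * u ^ m) (by fun_prop) (2 * m + 1 + 1)) _)
    (intervalIntegrable_div_one_add_pow (by fun_prop) _),
    intervalIntegral.integral_const_mul, integral_pow_div_one_add_pow] at hprim
  simp only [← mul_div_assoc] at hprim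
  have e1 : 2 * (m + 1) = 2 * m + 1 + 1 := by ring
  have e2 : 2 * m + 1 + 1 - 1 = 2 * m + 1 := by omega
  rw [e1, Nat.add_sub_cancel, e2, hsubst]
  have hI : ∫ u in (0 : ℝ)..1, (1 - u) * u ^ m / (1 + u) ^ (2 * m + 2) =
      (1 / 2 ^ (2 * m + 1) - (m.factorial : ℝ) ^ 2 / (2 * (2 * m + 1).factorial)) / m := by
    rw [eq_div_iff hm]
    simp only [one_pow, ne_eq, Nat.add_eq_zero_iff, one_ne_zero, and_false, not_false_eq_true,
      zero_pow, sub_zero] at hprim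
    linear_combination hprim
  have hf : ((2 * m + 1).factorial : ℝ) ≠ 0 := by positivity
  have hfm : (m.factorial : ℝ) ≠ 0 := by positivity
  rw [hI, Nat.factorial_succ (2 * m + 1)]
  push_cast
  rw [add_sub_cancel_right]
  field_simp
  ring
end
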